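/- Let P and A be complex n×n matrices, let γ and s be real numbers with γ ≠ 0, and suppose the vectors (u₁,u₂,v₁,v₂) and (u₁',u₂',v₁',v₂') in ℂⁿ each form a singular pair for F = [[P,0],[γA,P]] with singular value s. Then the 2×2 matrix M with entries M₁₁ = u₂ᴴ A v₁, M₁₂ = u₂ᴴ A v₁', M₂₁ = u₂'ᴴ A v₁, M₂₂ = u₂'ᴴ A v₁' is Hermitian. -/

import Mathlib

open Matrix

/-- `γ u₂ᴴ A v₁' = s (u₂ᴴ u₂' - v₂ᴴ v₂')`. -/
lemma key_aux {n : ℕ} (P A : Matrix (Fin n) (Fin n) ℂ) (γ s : ℝ)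
    (u v w x y : Fin n → ℂ)
    (h4 : Pᴴ.mulVec u = (s : ℂ) • v)
    (h2 : (γ : ℂ) • A.mulVec w + P.mulVec x = (s : ℂ) • y) :
    (γ : ℂ) * (star u ⬝ᵥ A.mulVec w) = s * (star u ⬝ᵥ y - star v ⬝ᵥ x) := by
  have e1 := congrArg (fun z => star u ⬝ᵥ z) h2
  have e2 := congrArg (fun z => star z ⬝ᵥ x) h4
  simp only [dotProduct_add, dotProduct_smul, smul_eq_mul] at e1
  simp only [star_mulVec, conjTranspose_conjTranspose, ← dotProduct_mulVec, star_smul,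
    smul_dotProduct, smul_eq_mul, RCLike.star_def, Complex.conj_ofReal] at e2
  linear_combination e1 - e2

lemma key_aux2 {n : ℕ} (P A : Matrix (Fin n) (Fin n) ℂ) (γ s : ℝ) (hγ : γ ≠ 0)
    (u₂ v₁ v₂ u₂' v₁' v₂' : Fin n → ℂ)
    (h2 : (γ : ℂ) • A.mulVec v₁ + P.mulVec v₂ = (s : ℂ) • u₂)
    (h4 : Pᴴ.mulVec u₂ = (s : ℂ) • v₂)
    (h2' : (γ : ℂ) • A.mulVec v₁' + P.mulVec v₂' = (s : ℂ) • u₂')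
    (h4' : Pᴴ.mulVec u₂' = (s : ℂ) • v₂') :
    star (star u₂' ⬝ᵥ A.mulVec v₁) = star u₂ ⬝ᵥ A.mulVec v₁' := by
  have a := key_aux P A γ s u₂ v₂ v₁' v₂' u₂' h4 h2'
  have b := congrArg star (key_aux P A γ s u₂' v₂' v₁ v₂ u₂ h4' h2)
  have hc : ∀ p q : Fin n → ℂ, star (star p ⬝ᵥ q) = star q ⬝ᵥ p := fun p q => by
    rw [star_dotProduct, star_star]
  have hr : ∀ r : ℝ, star (r : ℂ) = r := Complex.conj_ofReal
  have hg : (γ : ℂ) ≠ 0 := by exact_mod_cast hγ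
  apply mul_left_cancel₀ hg
  rw [a]
  rw [star_mul', star_mul', star_sub, hr, hr, hc u₂' u₂, hc v₂' v₂] at b
  exact b

/-- For two singular pairs of `F = [[P,0],[γA,P]]` with singular value `s` and `γ ≠ 0`,
the 2×2 matrix of the quantities `u₂ᴴ A v₁` is Hermitian. -/
theorem stmt_3 (n : ℕ) (P A : Matrix (Fin n) (Fin n) ℂ) (γ s : ℝ) (hγ : γ ≠ 0)
    (u₁ u₂ v₁ v₂ u₁' u₂' v₁' v₂' : Fin n → ℂ)
    (h1 : P.mulVec v₁ = (s : ℂ) • u₁)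
    (h2 : (γ : ℂ) • A.mulVec v₁ + P.mulVec v₂ = (s : ℂ) • u₂)
    (h3 : Pᴴ.mulVec u₁ + (γ : ℂ) • Aᴴ.mulVec u₂ = (s : ℂ) • v₁)
    (h4 : Pᴴ.mulVec u₂ = (s : ℂ) • v₂)
    (h1' : P.mulVec v₁' = (s : ℂ) • u₁')
    (h2' : (γ : ℂ) • A.mulVec v₁' + P.mulVec v₂' = (s : ℂ) • u₂')
    (h3' : Pᴴ.mulVec u₁' + (γ : ℂ) • Aᴴ.mulVec u₂' = (s : ℂ) • v₁')
    (h4' : Pᴴ.mulVec u₂' = (s : ℂ) • v₂') :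
    (!![star u₂ ⬝ᵥ A.mulVec v₁, star u₂ ⬝ᵥ A.mulVec v₁';
        star u₂' ⬝ᵥ A.mulVec v₁, star u₂' ⬝ᵥ A.mulVec v₁'] :
      Matrix (Fin 2) (Fin 2) ℂ).IsHermitian := by
  apply Matrix.IsHermitian.ext
  intro i j
  fin_cases i <;> fin_cases j
  · exact key_aux2 P A γ s hγ _ _ _ _ _ _ h2 h4 h2 h4
  · exact key_aux2 P A γ s hγ _ _ _ _ _ _ h2 h4 h2' h4'
  · exact key_aux2 P A γ s hγ _ _ _ _ _ _ h2' h4' h2 h4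
  · exact key_aux2 P A γ s hγ _ _ _ _ _ _ h2' h4' h2' h4'
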